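/- (Corollary 5.5.) Assume W is continuous and satisfies (H1)–(H4) and the normalization of the wells. Then K*₀ ≥ K₀. -/

import Mathlib

open MeasureTheory Filter Topology ENNReal NNReal Set

noncomputable section

/-- Vectors in ℝ³. -/
abbrev V3 := Fin 3 → ℝ

/-- 3×3 matrices, represented as the triple of their columns. -/
abbrev M33 := Fin 3 → V3

/-- Euclidean norm on ℝ³. -/
def vnorm (v : V3) : ℝ := Real.sqrt (∑ i, (v i) ^ 2)

/-- Frobenius (Euclidean) norm on 3×3 matrices. -/
def mnorm (ξ : M33) : ℝ := Real.sqrt (∑ j, ∑ i, (ξ j i) ^ 2)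

/-- dist(ξ,{A,B}). -/
def mdist (A B ξ : M33) : ℝ := min (mnorm (ξ - A)) (mnorm (ξ - B))

/-- Spatial points of ℝ³ = ℝ × ℝ × ℝ. -/
abbrev Pt := ℝ × ℝ × ℝ

/-- Directional partial derivative of a map `u : ℝ³ → ℝ³`. -/
def pd (e : Pt) (u : Pt → V3) (x : Pt) : V3 := fderiv ℝ u x e

def e1 : Pt := (1, 0, 0)
def e2 : Pt := (0, 1, 0)
def e3 : Pt := (0, 0, 1)

/-- Rescaled gradient ∇_h u = (∂₁u, ∂₂u, h⁻¹ ∂₃u), as a 3×3 matrix of columns. -/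
def gradh (h : ℝ) (u : Pt → V3) (x : Pt) : M33 :=
  ![pd e1 u x, pd e2 u x, h⁻¹ • pd e3 u x]

/-- Squared rescaled Hessian |∇²_h u|². -/
def hessh (h : ℝ) (u : Pt → V3) (x : Pt) : ℝ :=
  (vnorm (pd e1 (pd e1 u) x)) ^ 2 + (vnorm (pd e2 (pd e2 u) x)) ^ 2
    + (h⁻¹) ^ 4 * (vnorm (pd e3 (pd e3 u) x)) ^ 2
    + 2 * (vnorm (pd e2 (pd e1 u) x)) ^ 2
    + 2 * (h⁻¹) ^ 2 * (vnorm (pd e3 (pd e1 u) x)) ^ 2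
    + 2 * (h⁻¹) ^ 2 * (vnorm (pd e3 (pd e2 u) x)) ^ 2

/-- The energy F^h_ε(u, S) = ∫_S (1/ε) W(∇_h u) + ε |∇²_h u|², valued in [0,∞]. -/
def F (W : M33 → ℝ) (h ε : ℝ) (u : Pt → V3) (S : Set Pt) : ℝ≥0∞ :=
  ∫⁻ x in S, ENNReal.ofReal (ε⁻¹ * W (gradh h u x) + ε * hessh h u x)

/-- Hypothesis (H1): W ≥ 0, {W = 0} = {A, B}, A ≠ B, and A' − B' = 2 a ⊗ ν̄ for
some a ∈ ℝ³ and a unit vector ν̄ ∈ ℝ². -/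
def H1 (W : M33 → ℝ) (A B : M33) : Prop :=
  (∀ ξ, 0 ≤ W ξ) ∧ (∀ ξ, W ξ = 0 ↔ ξ = A ∨ ξ = B) ∧ A ≠ B ∧
    ∃ (a : V3) (ν : ℝ × ℝ), ν.1 ^ 2 + ν.2 ^ 2 = 1 ∧
      A 0 - B 0 = (2 * ν.1) • a ∧ A 1 - B 1 = (2 * ν.2) • a

/-- Hypothesis (H2): p-growth from above and below. -/
def H2 (W : M33 → ℝ) (p : ℝ) : Prop :=
  ∃ C > (0 : ℝ), ∀ ξ, C⁻¹ * (mnorm ξ) ^ p - C ≤ W ξ ∧ W ξ ≤ C * (mnorm ξ) ^ p + C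

/-- Hypothesis (H3): non-degeneracy near the wells. -/
def H3 (W : M33 → ℝ) (A B : M33) (p : ℝ) : Prop :=
  ∃ ϱ > (0 : ℝ), ∃ C > (0 : ℝ), ∀ ξ, mdist A B ξ ≤ ϱ →
    C⁻¹ * (mdist A B ξ) ^ p ≤ W ξ ∧ W ξ ≤ C * (mdist A B ξ) ^ p

/-- Hypothesis (H4): W(ξ₁, 0, ξ₃) ≤ W(ξ). -/
def H4 (W : M33 → ℝ) : Prop := ∀ ξ : M33, W ![ξ 0, 0, ξ 2] ≤ W ξ

/-- Normalization of the wells: A = −B, first column of A is a, second column is 0. -/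
def Wells (A B : M33) (a : V3) : Prop := A = -B ∧ A 0 = a ∧ A 1 = 0

/-- ū₀(t) = |t| a. -/
def ub0 (a : V3) (t : ℝ) : V3 := |t| • a

/-- b̄₀(t) = A₃ for t ≥ 0, −A₃ (= B₃) for t < 0. -/
def bb0 (A3 : V3) (t : ℝ) : V3 := if 0 ≤ t then A3 else -A3

/-- u₀(x) = ū₀(x₁). -/
def u0 (a : V3) (x : Pt) : V3 := ub0 a x.1

/-- b₀(x) = b̄₀(x₁). -/
def b0 (A3 : V3) (x : Pt) : V3 := bb0 A3 x.1

/-- The interval I = (−1/2, 1/2). -/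
def II : Set ℝ := Set.Ioo (-(1 / 2 : ℝ)) (1 / 2)

/-- The unit cube Q = I × I × I. -/
def Q3 : Set Pt := II ×ˢ (II ×ˢ II)

/-- J_ρ = (ρ I) × J × I. -/
def Jrho (J : Set ℝ) (ρ : ℝ) : Set Pt := (Set.Ioo (-(ρ / 2)) (ρ / 2)) ×ˢ (J ×ˢ II)

/-- The rescaled thin domain Ω = ω × I. -/
def Om (ω : Set (ℝ × ℝ)) : Set Pt := {x | (x.1, x.2.1) ∈ ω ∧ x.2.2 ∈ II}

/-- L¹ convergence on a set U. -/
def TendsL1 (U : Set Pt) (f : ℕ → Pt → V3) (g : Pt → V3) : Prop :=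
  Tendsto (fun n => ∫⁻ x in U, ENNReal.ofReal (vnorm (f n x - g x))) atTop (nhds 0)

/-- L^q convergence on a set U. -/
def TendsLp (U : Set Pt) (q : ℝ) (f : ℕ → Pt → V3) (g : Pt → V3) : Prop :=
  Tendsto (fun n => ∫⁻ x in U, ENNReal.ofReal ((vnorm (f n x - g x)) ^ q)) atTop (nhds 0)

/-- The localized asymptotic energy 𝓔_γ(J, ρ). -/
def Egam (W : M33 → ℝ) (a A3 : V3) (γ : ℝ) (J : Set ℝ) (ρ : ℝ) : ℝ≥0∞ :=
  sInf { L : ℝ≥0∞ | ∃ (h ε : ℕ → ℝ) (u : ℕ → Pt → V3),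
    (∀ n, 0 < h n) ∧ (∀ n, 0 < ε n) ∧
    Tendsto h atTop (nhds 0) ∧ Tendsto ε atTop (nhds 0) ∧
    Tendsto (fun n => h n / ε n) atTop (nhds γ) ∧
    (∀ n, ContDiffOn ℝ 2 (u n) (Jrho J ρ)) ∧
    TendsL1 (Jrho J ρ) u (u0 a) ∧
    TendsL1 (Jrho J ρ) (fun n x => (h n)⁻¹ • pd e3 (u n) x) (b0 A3) ∧
    L = Filter.liminf (fun n => F W (h n) (ε n) (u n) (Jrho J ρ)) atTop }

/-- K*_γ = 𝓔_γ(I, 1). -/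
def Kstar (W : M33 → ℝ) (a A3 : V3) (γ : ℝ) : ℝ≥0∞ := Egam W a A3 γ II 1

/-- K*_∞ : the analogue of K*_γ for h/ε → ∞, on the unit cube Q. -/
def KstarInf (W : M33 → ℝ) (a A3 : V3) : ℝ≥0∞ :=
  sInf { L : ℝ≥0∞ | ∃ (h ε : ℕ → ℝ) (u : ℕ → Pt → V3),
    (∀ n, 0 < h n) ∧ (∀ n, 0 < ε n) ∧
    Tendsto h atTop (nhds 0) ∧ Tendsto ε atTop (nhds 0) ∧
    Tendsto (fun n => h n / ε n) atTop atTop ∧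
    (∀ n, ContDiffOn ℝ 2 (u n) Q3) ∧
    TendsL1 Q3 u (u0 a) ∧
    TendsL1 Q3 (fun n x => (h n)⁻¹ • pd e3 (u n) x) (b0 A3) ∧
    L = Filter.liminf (fun n => F W (h n) (ε n) (u n) Q3) atTop }

open Classical in
/-- The phase matrix: B on E, A off E. -/
def Mfun (A B : M33) (E : Set (ℝ × ℝ)) (x' : ℝ × ℝ) : M33 := if x' ∈ E then B else A

/-! ### Two-dimensional objects -/

abbrev Pt2 := ℝ × ℝ

/-- Directional partial derivative of a map `v : ℝ² → ℝ³`. -/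
def qd (e : Pt2) (v : Pt2 → V3) (y : Pt2) : V3 := fderiv ℝ v y e

def f1 : Pt2 := (1, 0)
def f2 : Pt2 := (0, 1)

/-- 𝒲(∇v) = W(∂₁v, 0, ∂₂v). -/
def W2 (W : M33 → ℝ) (v : Pt2 → V3) (y : Pt2) : ℝ := W ![qd f1 v y, 0, qd f2 v y]

/-- Squared 2D Hessian |∇²v|². -/
def hess2d (v : Pt2 → V3) (y : Pt2) : ℝ :=
  (vnorm (qd f1 (qd f1 v) y)) ^ 2 + 2 * (vnorm (qd f2 (qd f1 v) y)) ^ 2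
    + (vnorm (qd f2 (qd f2 v) y)) ^ 2

/-- The rectangle ℓI × γI. -/
def Rect (ℓ γ : ℝ) : Set Pt2 := Set.Ioo (-(ℓ / 2)) (ℓ / 2) ×ˢ Set.Ioo (-(γ / 2)) (γ / 2)

/-- The optimal-profile constant K_γ of the critical regime. -/
def Kgam (W : M33 → ℝ) (a A3 : V3) (γ : ℝ) : ℝ≥0∞ :=
  sInf { L : ℝ≥0∞ | ∃ ℓ > (0 : ℝ), ∃ v : Pt2 → V3,
    ContDiffOn ℝ 2 v (Rect ℓ γ) ∧
    (∃ δ > (0 : ℝ), ∀ y ∈ Rect ℓ γ, ℓ / 2 - δ < y.1 → qd f1 v y = a ∧ qd f2 v y = A3) ∧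
    (∃ δ > (0 : ℝ), ∀ y ∈ Rect ℓ γ, y.1 < -(ℓ / 2) + δ → qd f1 v y = -a ∧ qd f2 v y = -A3) ∧
    L = ENNReal.ofReal γ⁻¹ *
      ∫⁻ y in Rect ℓ γ, ENNReal.ofReal (W2 W v y + hess2d v y) }

/-- The 2D subcritical functional F⁰_ε(u, b, D). -/
def F0 (W : M33 → ℝ) (ε : ℝ) (u b : Pt2 → V3) (D : Set Pt2) : ℝ≥0∞ :=
  ∫⁻ y in D, ENNReal.ofReal (ε⁻¹ * W ![qd f1 u y, qd f2 u y, b y]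
    + ε * ((vnorm (qd f1 (qd f1 u) y)) ^ 2 + 2 * (vnorm (qd f2 (qd f1 u) y)) ^ 2
      + (vnorm (qd f2 (qd f2 u) y)) ^ 2
      + 2 * (vnorm (qd f1 b y)) ^ 2 + 2 * (vnorm (qd f2 b y)) ^ 2))

/-- K*₀: the subcritical cell constant. -/
def Kstar0 (W : M33 → ℝ) (a A3 : V3) : ℝ≥0∞ :=
  sInf { L : ℝ≥0∞ | ∃ (ε : ℕ → ℝ) (u b : ℕ → Pt2 → V3),
    (∀ n, 0 < ε n) ∧ Tendsto ε atTop (nhds 0) ∧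
    (∀ n, ContDiffOn ℝ 2 (u n) (II ×ˢ II)) ∧ (∀ n, ContDiffOn ℝ 1 (b n) (II ×ˢ II)) ∧
    Tendsto (fun n => ∫⁻ y in II ×ˢ II,
      ENNReal.ofReal (vnorm (u n y - ub0 a y.1) + vnorm (b n y - bb0 A3 y.1)))
      atTop (nhds 0) ∧
    L = Filter.liminf (fun n => F0 W (ε n) (u n) (b n) (II ×ˢ II)) atTop }

/-- K₀: the subcritical optimal-profile constant. -/
def K0 (W : M33 → ℝ) (a A3 : V3) : ℝ≥0∞ :=
  sInf { L : ℝ≥0∞ | ∃ ℓ > (0 : ℝ), ∃ φ1 φ2 : ℝ → V3,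
    ContDiffOn ℝ 1 φ1 (Set.Icc (-ℓ) ℓ) ∧ ContDiffOn ℝ 1 φ2 (Set.Icc (-ℓ) ℓ) ∧
    φ1 ℓ = a ∧ φ2 ℓ = A3 ∧ φ1 (-ℓ) = -a ∧ φ2 (-ℓ) = -A3 ∧
    L = ∫⁻ t in Set.Ioo (-ℓ) ℓ, ENNReal.ofReal (W ![φ1 t, 0, φ2 t]
      + (vnorm (derivWithin φ1 (Set.Icc (-ℓ) ℓ) t)) ^ 2
      + 2 * (vnorm (derivWithin φ2 (Set.Icc (-ℓ) ℓ) t)) ^ 2) }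

/-- K_∞ in the case λ = 0. -/
def KinfZero (W : M33 → ℝ) (a : V3) : ℝ≥0∞ :=
  sInf { L : ℝ≥0∞ | ∃ ℓ > (0 : ℝ), ∃ v : Pt2 → V3,
    ContDiff ℝ 2 v ∧ (∀ y : Pt2, v (y.1, y.2 + 1) = v y) ∧
    (∃ δ > (0 : ℝ), ∀ y : Pt2, |y.1 - 1 / 2| < δ → qd f1 v y = a ∧ qd f2 v y = 0) ∧
    (∃ δ > (0 : ℝ), ∀ y : Pt2, |y.1 + 1 / 2| < δ → qd f1 v y = -a ∧ qd f2 v y = 0) ∧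
    L = ∫⁻ y in II ×ˢ II, ENNReal.ofReal (ℓ * W2 W v y + ℓ⁻¹ * hess2d v y) }

/-- The unit normal ν_λ = (1+λ²)^{-1/2} (1, λ). -/
def nuv (lam : ℝ) : Pt2 := (1 / Real.sqrt (1 + lam ^ 2), lam / Real.sqrt (1 + lam ^ 2))

/-- The orthogonal direction ν_λ^⊥ = (1+λ²)^{-1/2} (−λ, 1). -/
def nupv (lam : ℝ) : Pt2 := (-lam / Real.sqrt (1 + lam ^ 2), 1 / Real.sqrt (1 + lam ^ 2))

/-- Dot product on ℝ². -/
def dotp (w y : Pt2) : ℝ := w.1 * y.1 + w.2 * y.2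

/-- The unit square Q'_λ centered at 0 with two sides orthogonal to ν_λ. -/
def Qlam (lam : ℝ) : Set Pt2 := {y | |dotp (nuv lam) y| < 1 / 2 ∧ |dotp (nupv lam) y| < 1 / 2}

/-- K_∞ for general λ. -/
def KinfL (W : M33 → ℝ) (a : V3) (lam : ℝ) : ℝ≥0∞ :=
  ENNReal.ofReal (Real.sqrt (1 + lam ^ 2)) *
    sInf { L : ℝ≥0∞ | ∃ ℓ > (0 : ℝ), ∃ v : Pt2 → V3,
      ContDiff ℝ 2 v ∧ (∀ y : Pt2, v (y + nupv lam) = v y) ∧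
      (∃ δ > (0 : ℝ), ∀ y : Pt2, |dotp (nuv lam) y - 1 / 2| < δ →
        qd f1 v y = a ∧ qd f2 v y = lam • a) ∧
      (∃ δ > (0 : ℝ), ∀ y : Pt2, |dotp (nuv lam) y + 1 / 2| < δ →
        qd f1 v y = -a ∧ qd f2 v y = -(lam • a)) ∧
      L = ∫⁻ y in Qlam lam, ENNReal.ofReal (ℓ * W2 W v y + ℓ⁻¹ * hess2d v y) }

/-- Number of interfaces strictly below t. -/
def cnt (m : ℕ) (α : Fin m → ℝ) (t : ℝ) : ℕ := (Finset.univ.filter (fun i => α i < t)).card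

end
/-- `z` is continuously differentiable on `[s, t]` with derivative `z'`. -/
structure IsC1PathOn {E : Type*} [NormedAddCommGroup E] [NormedSpace ℝ E]
    (z z' : ℝ → E) (s t : ℝ) : Prop where
  deriv : ∀ x ∈ Icc s t, HasDerivWithinAt z (z' x) (Icc s t) x
  cont : ContinuousOn z' (Icc s t)

/-- `(x, v)` can be joined to `(y, w)` by a `C¹` path of action at most `c`
for the Lagrangian `φ`. -/
def Joins {E : Type*} [NormedAddCommGroup E] [NormedSpace ℝ E]
    (φ : E → E → ℝ) (x v y w : E) (c : ℝ) : Prop :=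
  ∃ T > (0 : ℝ), ∃ z z' : ℝ → E, IsC1PathOn z z' 0 T ∧ z 0 = x ∧ z' 0 = v ∧ z T = y ∧ z' T = w ∧
    ∫ t in (0 : ℝ)..T, φ (z t) (z' t) ≤ c

section Paths

variable {E : Type*} [NormedAddCommGroup E] [NormedSpace ℝ E]

namespace IsC1PathOn

lemma continuousOn {z z' : ℝ → E} {s t : ℝ} (h : IsC1PathOn z z' s t) :
    ContinuousOn z (Icc s t) := fun x hx => (h.deriv x hx).continuousWithinAt

lemma continuousOn_lagrangian {z z' : ℝ → E} {s t : ℝ} (h : IsC1PathOn z z' s t)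
    {φ : E → E → ℝ} (hφ : Continuous fun q : E × E => φ q.1 q.2) :
    ContinuousOn (fun x => φ (z x) (z' x)) (Icc s t) :=
  hφ.comp_continuousOn (h.continuousOn.prodMk h.cont)

lemma comp_affine {z z' : ℝ → E} {s t s' t' k d : ℝ} (h : IsC1PathOn z z' s t) (hk : 0 ≤ k)
    (hs : k * s' + d = s) (ht : k * t' + d = t) :
    IsC1PathOn (fun x => z (k * x + d)) (fun x => k • z' (k * x + d)) s' t' := by
  have hm : MapsTo (fun x : ℝ => k * x + d) (Icc s' t') (Icc s t) := by
    intro x hx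
    have h1 := mul_le_mul_of_nonneg_left hx.1 hk
    have h2 := mul_le_mul_of_nonneg_left hx.2 hk
    exact ⟨by simp only; linarith, by simp only; linarith⟩
  refine ⟨fun x hx => ?_, ?_⟩
  · have hd : HasDerivWithinAt (fun x : ℝ => k * x + d) k (Icc s' t') x := by
      simpa using (((hasDerivAt_id x).const_mul k).add_const d).hasDerivWithinAt
    exact (h.deriv _ (hm hx)).scomp x hd hm
  · exact continuousOn_const.smul (h.cont.comp (by fun_prop) hm)

lemma glue {z z' y y' : ℝ → E} {s m t : ℝ} (hz : IsC1PathOn z z' s m) (hy : IsC1PathOn y y' m t)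
    (hsm : s ≤ m) (hmt : m ≤ t) (h0 : z m = y m) (h1 : z' m = y' m) :
    IsC1PathOn (fun x => if x ≤ m then z x else y x) (fun x => if x ≤ m then z' x else y' x)
      s t := by
  have eqz : ∀ x ∈ Icc s m, (if x ≤ m then z x else y x) = z x := fun x hx => if_pos hx.2
  have eqz' : ∀ x ∈ Icc s m, (if x ≤ m then z' x else y' x) = z' x := fun x hx => if_pos hx.2
  have eqy : ∀ x ∈ Icc m t, (if x ≤ m then z x else y x) = y x := by
    intro x hx
    split_ifs with h
    · rw [le_antisymm h hx.1, h0]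
    · rfl
  have eqy' : ∀ x ∈ Icc m t, (if x ≤ m then z' x else y' x) = y' x := by
    intro x hx
    split_ifs with h
    · rw [le_antisymm h hx.1, h1]
    · rfl
  have hU : Icc s m ∪ Icc m t = Icc s t := Icc_union_Icc_eq_Icc hsm hmt
  refine ⟨fun x hx => ?_, ?_⟩
  · rw [← hU]
    refine HasDerivWithinAt.union ?_ ?_
    · by_cases hxm : x ≤ m
      · have hx' : x ∈ Icc s m := ⟨hx.1, hxm⟩
        rw [eqz' x hx']
        exact (hz.deriv x hx').congr eqz (eqz x hx')
      · have : x ∉ closure (Icc s m) := by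
          rw [isClosed_Icc.closure_eq]; exact fun h => hxm h.2
        exact HasFDerivWithinAt.of_notMem_closure this
    · by_cases hxm : m ≤ x
      · have hx' : x ∈ Icc m t := ⟨hxm, hx.2⟩
        rw [eqy' x hx']
        exact (hy.deriv x hx').congr eqy (eqy x hx')
      · have : x ∉ closure (Icc m t) := by
          rw [isClosed_Icc.closure_eq]; exact fun h => hxm h.1
        exact HasFDerivWithinAt.of_notMem_closure this
  · rw [← hU]
    exact (hz.cont.congr eqz').union_of_isClosed (hy.cont.congr eqy') isClosed_Icc isClosed_Icc

end IsC1PathOn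

namespace Joins

variable {φ : E → E → ℝ}

lemma trans (hφ : Continuous fun q : E × E => φ q.1 q.2) {x₀ v₀ x₁ v₁ x₂ v₂ : E} {c d : ℝ}
    (h : Joins φ x₀ v₀ x₁ v₁ c) (h' : Joins φ x₁ v₁ x₂ v₂ d) :
    Joins φ x₀ v₀ x₂ v₂ (c + d) := by
  obtain ⟨T, hT, z, z', hz, hz0, hz0', hzT, hzT', hc⟩ := h
  obtain ⟨S, hS, y, y', hy, hy0, hy0', hyS, hyS', hd⟩ := h'
  have hy2 := hy.comp_affine (s' := T) (t' := T + S) (k := 1) (d := -T) zero_le_one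
    (by ring) (by ring)
  have hg := hz.glue hy2 hT.le (by linarith) (by simp [hzT, hy0]) (by simp [hzT', hy0'])
  refine ⟨T + S, by linarith, _, _, hg, by simp [hT.le, hz0], by simp [hT.le, hz0'],
    by simp [hS, hyS], by simp [hS, hyS'], ?_⟩
  have hcont := hg.continuousOn_lagrangian hφ
  rw [← intervalIntegral.integral_add_adjacent_intervals (b := T)
    ((hcont.mono (Icc_subset_Icc le_rfl (by linarith))).intervalIntegrable_of_Icc hT.le)
    ((hcont.mono (Icc_subset_Icc hT.le le_rfl)).intervalIntegrable_of_Icc (by linarith))]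
  refine add_le_add (le_trans (le_of_eq ?_) hc) (le_trans (le_of_eq ?_) hd)
  · refine intervalIntegral.integral_congr fun t ht => ?_
    rw [uIcc_of_le hT.le] at ht
    simp [ht.2]
  · have := intervalIntegral.integral_comp_sub_right (a := T) (b := T + S)
      (fun t => φ (y t) (y' t)) T
    simp only [sub_self, add_sub_cancel_left] at this
    rw [← this]
    refine intervalIntegral.integral_congr fun t ht => ?_
    rw [uIcc_of_le (by linarith)] at ht
    rcases eq_or_lt_of_le ht.1 with h | h
    · subst h; simp [hzT, hzT', hy0, hy0']
    · simp [not_le.2 h, sub_eq_add_neg]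

/-- A path on an arbitrary interval, traversed with speed `k`. -/
lemma of_path {z z' : ℝ → E} {s t k c : ℝ} (hst : s < t) (hk : 0 < k) (h : IsC1PathOn z z' s t)
    (hc : ∫ x in s..t, k⁻¹ * φ (z x) (k • z' x) ≤ c) :
    Joins φ (z s) (k • z' s) (z t) (k • z' t) c := by
  have hT : k * ((t - s) / k) + s = t := by field_simp; ring
  refine ⟨(t - s) / k, div_pos (by linarith) hk, _, _,
    h.comp_affine (s' := 0) (t' := (t - s) / k) hk.le (by ring) hT, by simp, by simp,
    by simp only [hT], by simp only [hT], ?_⟩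
  have := intervalIntegral.integral_comp_mul_add (a := 0) (b := (t - s) / k)
    (fun x => φ (z x) (k • z' x)) hk.ne' s
  simp only [mul_zero, zero_add, hT] at this
  rw [this, smul_eq_mul, ← intervalIntegral.integral_const_mul]
  exact hc

lemma of_bound {z z' : ℝ → E} {s t c : ℝ} (hst : s < t) (h1 : t - s ≤ 1) (hc0 : 0 ≤ c)
    (hφ : Continuous fun q : E × E => φ q.1 q.2) (h : IsC1PathOn z z' s t)
    (hc : ∀ x ∈ Icc s t, φ (z x) (z' x) ≤ c) :
    Joins φ (z s) (z' s) (z t) (z' t) c := by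
  have := of_path (φ := φ) (k := 1) (c := c) hst one_pos h ?_
  · simpa using this
  · simp only [inv_one, one_mul, one_smul]
    calc ∫ x in s..t, φ (z x) (z' x) ≤ ∫ _ in s..t, c :=
          intervalIntegral.integral_mono_on hst.le
            ((h.continuousOn_lagrangian hφ).intervalIntegrable_of_Icc hst.le)
            intervalIntegrable_const hc
      _ = (t - s) * c := by simp
      _ ≤ c := by nlinarith

/-- Close to a rest point of the Lagrangian, short connections to it are cheap. -/
lemma exists_cap (hφ : Continuous fun q : E × E => φ q.1 q.2) {P : E} (hP : φ P 0 = 0)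
    {δ : ℝ} (hδ : 0 < δ) :
    ∃ ρ > (0 : ℝ), ∀ x v : E, ‖x - P‖ ≤ ρ → ‖v‖ ≤ ρ →
      (∃ w, Joins φ x v P w δ) ∧ ∃ w, Joins φ P w x v δ := by
  have hev : ∀ᶠ q : E × E in 𝓝 (P, 0), φ q.1 q.2 < δ :=
    hφ.continuousAt.eventually_lt continuousAt_const (by simpa [hP] using hδ)
  obtain ⟨r, hr, hball⟩ := Metric.eventually_nhds_iff.1 hev
  have hdist : ∀ z w : E, ‖z - P‖ < r → ‖w‖ < r → φ z w ≤ δ := by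
    intro z w hz hw
    refine (hball (y := (z, w)) ?_).le
    rw [Prod.dist_eq, dist_eq_norm, dist_eq_norm]
    simpa using ⟨hz, hw⟩
  refine ⟨r / 4, by positivity, fun x v hx hv => ?_⟩
  have key : ∀ σ : ℝ, |σ| = 1 → ∀ t : ℝ, |t| ≤ 1 → 0 ≤ σ * t →
      φ (P + ((1 - t ^ 2) • (x - P) + (t - σ * t ^ 2) • v))
        ((-(2 * t)) • (x - P) + (1 - σ * (2 * t)) • v) ≤ δ := by
    intro σ hσ t ht hs
    have hσ2 : σ * σ = 1 := by rw [← abs_mul_abs_self, hσ, one_mul]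
    have hst : σ * t = |t| := by rw [← abs_of_nonneg hs, abs_mul, hσ, one_mul]
    have ht2 : t ^ 2 = |t| ^ 2 := (sq_abs t).symm
    have h0 := abs_nonneg t
    apply hdist
    · rw [add_sub_cancel_left]
      refine (norm_add_le _ _).trans_lt ?_
      rw [norm_smul, norm_smul, Real.norm_eq_abs, Real.norm_eq_abs]
      have e1 : |1 - t ^ 2| ≤ 1 := by rw [abs_le]; constructor <;> nlinarith
      have e2 : |t - σ * t ^ 2| ≤ 1 := by
        have : t - σ * t ^ 2 = t * (1 - |t|) := by rw [← hst]; ring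
        rw [this, abs_mul, abs_of_nonneg (by linarith : 0 ≤ 1 - |t|)]
        nlinarith
      nlinarith [norm_nonneg (x - P), norm_nonneg v]
    · refine (norm_add_le _ _).trans_lt ?_
      rw [norm_smul, norm_smul, Real.norm_eq_abs, Real.norm_eq_abs]
      have e1 : |-(2 * t)| ≤ 2 := by
        rw [abs_neg, abs_mul, abs_of_pos (by norm_num : (0 : ℝ) < 2)]; linarith
      have e2 : |1 - σ * (2 * t)| ≤ 1 := by
        have : 1 - σ * (2 * t) = 1 - 2 * |t| := by rw [← hst]; ring
        rw [this, abs_le]; constructor <;> linarith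
      nlinarith [norm_nonneg (x - P), norm_nonneg v]
  have path : ∀ σ s t : ℝ, IsC1PathOn
      (fun t => P + ((1 - t ^ 2) • (x - P) + (t - σ * t ^ 2) • v))
      (fun t => (-(2 * t)) • (x - P) + (1 - σ * (2 * t)) • v) s t := by
    intro σ s t
    refine ⟨fun y _ => HasDerivAt.hasDerivWithinAt ?_, by fun_prop⟩
    have d1 : HasDerivAt (fun t : ℝ => 1 - t ^ 2) (-(2 * y)) y := by
      simpa using (hasDerivAt_pow 2 y).const_sub 1
    have d2 : HasDerivAt (fun t : ℝ => t - σ * t ^ 2) (1 - σ * (2 * y)) y := by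
      simpa using (hasDerivAt_id' y).fun_sub ((hasDerivAt_pow 2 y).const_mul σ)
    exact ((d1.smul_const (x - P)).add (d2.smul_const v)).const_add P
  constructor
  · have := of_bound (s := 0) (t := 1) one_pos (by norm_num) hδ.le hφ (path 1 0 1)
      (fun t ht => key 1 (by simp) t (abs_le.2 ⟨by linarith [ht.1], ht.2⟩) (by linarith [ht.1]))
    exact ⟨_, by simpa using this⟩
  · have := of_bound (s := -1) (t := 0) (by norm_num) (by norm_num) hδ.le hφ (path (-1) (-1) 0)
      (fun t ht => key (-1) (by simp) t (abs_le.2 ⟨ht.1, by linarith [ht.2]⟩)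
        (by linarith [ht.2]))
    exact ⟨_, by simpa using this⟩

end Joins

end Paths

lemma exists_le_of_setLIntegral_le {g : ℝ → ℝ} {α β s t η : ℝ} (hη : 0 < η)
    (hg : ∫⁻ x in Ioo α β, ENNReal.ofReal (g x) ≤ ENNReal.ofReal η)
    (hst : 1 / 6 ≤ t - s) (hsub : Ioo s t ⊆ Ioo α β) : ∃ x ∈ Ioo s t, g x ≤ 7 * η := by
  by_contra! hcon
  have h1 : ∫⁻ _ in Ioo s t, ENNReal.ofReal (7 * η) ≤ ENNReal.ofReal η :=
    (setLIntegral_mono' measurableSet_Ioo fun x hx => ENNReal.ofReal_le_ofReal (hcon x hx).le).trans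
      ((lintegral_mono_set hsub).trans hg)
  rw [setLIntegral_const, Real.volume_Ioo, ← ENNReal.ofReal_mul (by positivity),
    ENNReal.ofReal_le_ofReal_iff hη.le] at h1
  nlinarith

/-- If the gradient `z₁` of `w` and `z₂` are close to `-e` and `-f` while `w` and `z₂` are close in
`L¹` to `t • e` and `f`, then `e` and `f` are small. -/
lemma norm_well_le {X : Type*} [NormedAddCommGroup X] [NormedSpace ℝ X] [CompleteSpace X]
    {α β r c L η : ℝ} {w z₁ z₂ : ℝ → X} {e f : X} {G : ℝ → ℝ} (hαβ : β = α + 1 / 2)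
    (hη : 0 < η) (hr : 0 ≤ r) (hc : 0 ≤ c)
    (hw : ∀ t ∈ Ioo α β, HasDerivAt w (z₁ t) t) (hz₁ : ContinuousOn z₁ (Ioo α β))
    (hGi : IntegrableOn G (Ioo α β)) (hG0 : ∀ t, 0 ≤ G t) (hGL : ∫ t in Ioo α β, G t ≤ L)
    (h1 : ∀ t ∈ Ioo α β, ‖z₁ t + e‖ ≤ r + c * G t) (h2 : ∀ t ∈ Ioo α β, ‖z₂ t + f‖ ≤ r + c * G t)
    (hD : ∫⁻ t in Ioo α β, ENNReal.ofReal (‖w t - t • e‖ + ‖z₂ t - f‖) ≤ ENNReal.ofReal η) :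
    ‖e‖ ≤ 3 * (14 * η + r / 2 + c * L) ∧ ‖f‖ ≤ r / 2 + c * L + η := by
  have hvol : (volume.restrict (Ioo α β)).real univ = 1 / 2 := by
    rw [measureReal_restrict_apply_univ, Real.volume_real_Ioo, hαβ]; norm_num
  have hHi : IntegrableOn (fun t => r + c * G t) (Ioo α β) :=
    (integrable_const r).add (hGi.const_mul c)
  have hH0 : ∀ t, 0 ≤ r + c * G t := fun t => add_nonneg hr (mul_nonneg hc (hG0 t))
  have hHint : ∫ t in Ioo α β, (r + c * G t) ≤ r / 2 + c * L := by
    rw [integral_add (integrable_const r) (hGi.const_mul c), integral_const, integral_const_mul,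
      hvol, smul_eq_mul]
    nlinarith [mul_le_mul_of_nonneg_left hGL hc]
  have hL0 : 0 ≤ r / 2 + c * L := le_trans (integral_nonneg hH0) hHint
  constructor
  · obtain ⟨s, hs, hsD⟩ := exists_le_of_setLIntegral_le (s := α) (t := α + 1 / 6) hη hD
      (by linarith) (Ioo_subset_Ioo le_rfl (by linarith))
    obtain ⟨t, ht, htD⟩ := exists_le_of_setLIntegral_le (s := α + 1 / 3) (t := β) hη hD
      (by linarith) (Ioo_subset_Ioo (by linarith) le_rfl)
    have hst : s ≤ t := by linarith [hs.2, ht.1]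
    have hsub : Icc s t ⊆ Ioo α β := fun x hx => ⟨hs.1.trans_le hx.1, hx.2.trans_lt ht.2⟩
    have hv : ‖(w t + t • e) - (w s + s • e)‖ ≤ r / 2 + c * L := by
      have hint : ∫ x in s..t, (z₁ x + e) = (w t + t • e) - (w s + s • e) := by
        refine intervalIntegral.integral_eq_sub_of_hasDerivAt
          (f := fun x => w x + x • e) (fun x hx => ?_) ?_
        · rw [uIcc_of_le hst] at hx
          simpa using (hw x (hsub hx)).fun_add ((hasDerivAt_id' x).smul_const e)
        · exact ((hz₁.mono hsub).add continuousOn_const).intervalIntegrable_of_Icc hst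
      rw [← hint]
      refine (intervalIntegral.norm_integral_le_of_norm_le hst (ae_of_all _ fun x hx =>
        h1 x (hsub ⟨hx.1.le, hx.2⟩)) ?_).trans (le_trans ?_ hHint)
      · rw [intervalIntegrable_iff_integrableOn_Ioc_of_le hst]
        exact hHi.mono_set fun x hx => hsub ⟨hx.1.le, hx.2⟩
      · rw [intervalIntegral.integral_of_le hst]
        exact setIntegral_mono_set hHi (ae_of_all _ hH0)
          (ae_of_all _ fun x hx => hsub ⟨hx.1.le, hx.2⟩)
    have hid : (2 * (t - s)) • e = ((w t + t • e) - (w s + s • e))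
        - (w t - t • e) + (w s - s • e) := by module
    have hn : ‖(2 * (t - s)) • e‖ ≤ (r / 2 + c * L) + 7 * η + 7 * η := by
      rw [hid]
      refine (norm_add_le _ _).trans (add_le_add ((norm_sub_le _ _).trans (add_le_add hv ?_)) ?_)
      · exact le_trans (le_add_of_nonneg_right (norm_nonneg _)) htD
      · exact le_trans (le_add_of_nonneg_right (norm_nonneg _)) hsD
    rw [norm_smul, Real.norm_eq_abs, abs_of_nonneg (by linarith)] at hn
    nlinarith [norm_nonneg e, hs.2, ht.1]
  · have hconst : ∫⁻ _ in Ioo α β, ENNReal.ofReal (2 * ‖f‖) ≤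
        ENNReal.ofReal (r / 2 + c * L) + ENNReal.ofReal η := by
      calc ∫⁻ _ in Ioo α β, ENNReal.ofReal (2 * ‖f‖)
          ≤ ∫⁻ t in Ioo α β, (ENNReal.ofReal (r + c * G t) +
              ENNReal.ofReal (‖w t - t • e‖ + ‖z₂ t - f‖)) := by
            refine setLIntegral_mono' measurableSet_Ioo fun t ht => ?_
            rw [← ENNReal.ofReal_add (hH0 t) (by positivity)]
            apply ENNReal.ofReal_le_ofReal
            have hff : ‖(2 : ℝ) • f‖ ≤ ‖z₂ t + f‖ + ‖z₂ t - f‖ := by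
              have : (2 : ℝ) • f = (z₂ t + f) - (z₂ t - f) := by module
              rw [this]; exact norm_sub_le _ _
            rw [norm_smul, Real.norm_eq_abs, abs_two] at hff
            linarith [h2 t ht, norm_nonneg (w t - t • e)]
        _ = (∫⁻ t in Ioo α β, ENNReal.ofReal (r + c * G t)) +
              ∫⁻ t in Ioo α β, ENNReal.ofReal (‖w t - t • e‖ + ‖z₂ t - f‖) :=
            lintegral_add_left' hHi.aestronglyMeasurable.aemeasurable.ennreal_ofReal _
        _ ≤ _ := by
            refine add_le_add ?_ hD
            rw [← ofReal_integral_eq_lintegral_ofReal hHi (ae_of_all _ hH0)]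
            exact ENNReal.ofReal_le_ofReal hHint
    rw [setLIntegral_const, Real.volume_Ioo, ← ENNReal.ofReal_mul (by positivity),
      ← ENNReal.ofReal_add hL0 hη.le, ENNReal.ofReal_le_ofReal_iff (by positivity), hαβ] at hconst
    linarith

lemma exists_near_well {X : Type*} [NormedAddCommGroup X] [NormedSpace ℝ X] [CompleteSpace X]
    {V : X × X → ℝ} {P : X × X} {C L ρ : ℝ} (hC : 0 ≤ C)
    (hgrowth : ∀ ξ, ‖ξ‖ ≤ C * (V ξ + 1))
    (hwell : ∀ r > (0 : ℝ), ∃ κ > (0 : ℝ), ∀ ξ, V ξ ≤ κ → ‖ξ - P‖ ≤ r ∨ ‖ξ + P‖ ≤ r)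
    (hP : P ≠ 0) (hL : 0 ≤ L) (hρ : 0 < ρ) :
    ∃ η > (0 : ℝ), ∀ ε, 0 < ε → ε ≤ η → ∀ (α β : ℝ) (w z₁ z₂ : ℝ → X) (G : ℝ → ℝ),
      β = α + 1 / 2 → (∀ t ∈ Ioo α β, HasDerivAt w (z₁ t) t) → ContinuousOn z₁ (Ioo α β) →
      IntegrableOn G (Ioo α β) → (∀ t, 0 ≤ G t) → ∫ t in Ioo α β, G t ≤ L →
      (∀ t, V (z₁ t, z₂ t) ≤ ε * G t) →
      ∫⁻ t in Ioo α β, ENNReal.ofReal (‖w t - t • P.1‖ + ‖z₂ t - P.2‖) ≤ ENNReal.ofReal η →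
      ∃ t ∈ Ioo α β, ‖(z₁ t, z₂ t) - P‖ ≤ ρ ∧ ε * G t ≤ ρ ^ 2 := by
  set m := ‖P‖ with hm
  have hm0 : 0 < m := norm_pos_iff.2 hP
  obtain ⟨κ, hκ, hκw⟩ := hwell (min ρ (m / 6)) (lt_min hρ (by positivity))
  set r := min ρ (m / 6) with hr
  have hr0 : 0 < r := lt_min hρ (by positivity)
  have hrρ : r ≤ ρ := min_le_left _ _
  have hrm : r ≤ m / 6 := min_le_right _ _
  set K := 24 * (C + m) * (L + 1) / m with hK
  have hK0 : 0 < K := by positivity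
  set η := min (min (m / 336) (m / (24 * (C + 1) * (L + 1)))) (min (κ / K) (ρ ^ 2 / K)) with hη
  have hη0 : 0 < η := by
    refine lt_min (lt_min ?_ ?_) (lt_min ?_ ?_) <;> positivity
  refine ⟨η, hη0, fun ε hε hεη α β w z₁ z₂ G hαβ hw hz₁ hGi hG0 hGL hVG hD => ?_⟩
  have hη1 : η ≤ m / 336 := (min_le_left _ _).trans (min_le_left _ _)
  have hη2 : η ≤ m / (24 * (C + 1) * (L + 1)) := (min_le_left _ _).trans (min_le_right _ _)
  have hη3 : η ≤ κ / K := (min_le_right _ _).trans (min_le_left _ _)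
  have hη4 : η ≤ ρ ^ 2 / K := (min_le_right _ _).trans (min_le_right _ _)
  rw [le_div_iff₀ (by positivity)] at hη2
  rw [le_div_iff₀ hK0] at hη3 hη4
  by_contra! hcon
  have key : ∀ t ∈ Ioo α β, ‖(z₁ t, z₂ t) + P‖ ≤ r + (C * ε + (C + m) / K) * G t := by
    intro t ht
    have hc0 : 0 ≤ (C * ε + (C + m) / K) * G t := mul_nonneg (by positivity) (hG0 t)
    rcases le_or_gt (G t) K with hGK | hGK
    · have hεG : ε * G t ≤ η * K := mul_le_mul hεη hGK (hG0 t) hη0.le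
      rcases hκw _ ((hVG t).trans (hεG.trans hη3)) with h | h
      · exact absurd (hεG.trans hη4) (not_le.2 (hcon t ht (h.trans hrρ)))
      · linarith
    · have h1 : C + m ≤ (C + m) / K * G t := by
        rw [div_mul_eq_mul_div, le_div_iff₀ hK0]
        exact mul_le_mul_of_nonneg_left hGK.le (by positivity)
      have h2 := mul_le_mul_of_nonneg_left (hVG t) hC
      have h3 := hgrowth (z₁ t, z₂ t)
      have h4 := norm_add_le (z₁ t, z₂ t) P
      nlinarith
  have hres := norm_well_le (e := P.1) (f := P.2) (z₂ := z₂) hαβ hη0 hr0.le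
    (by positivity : 0 ≤ C * ε + (C + m) / K) hw hz₁ hGi hG0 hGL
    (fun t ht => (norm_fst_le ((z₁ t, z₂ t) + P)).trans (key t ht))
    (fun t ht => (norm_snd_le ((z₁ t, z₂ t) + P)).trans (key t ht)) hD
  have hc1 : C * ε * L ≤ m / 24 := by
    have h1 : C * ε * L ≤ C * η * L := by gcongr
    nlinarith [mul_nonneg hη0.le hC, mul_nonneg hη0.le hL, mul_nonneg (mul_nonneg hη0.le hC) hL]
  have hc2 : (C + m) / K * L ≤ m / 24 := by
    have : (C + m) / K * L = m / 24 * (L / (L + 1)) := by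
      rw [hK]; field_simp
    rw [this]
    have : L / (L + 1) ≤ 1 := by rw [div_le_one (by positivity)]; linarith
    nlinarith
  have hmax : m ≤ max ‖P.1‖ ‖P.2‖ := le_of_eq (Prod.norm_def P)
  have : max ‖P.1‖ ‖P.2‖ < m := by
    refine max_lt ?_ ?_
    · nlinarith [hres.1]
    · nlinarith [hres.2]
  linarith

/-- A slice of finite rescaled energy whose ends lie in different wells yields a connection of the
wells with almost no more action. -/
lemma exists_joins_wells {V q : V3 × V3 → ℝ} {P : V3 × V3} {C L δ : ℝ} (hVc : Continuous V)
    (hqc : Continuous q) (hV : ∀ ξ, 0 ≤ V ξ) (hVP : V P = 0) (hVP' : V (-P) = 0) (hq0 : q 0 = 0)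
    (hq : ∀ v, ‖v‖ ^ 2 ≤ q v) (hqs : ∀ (k : ℝ) v, q (k • v) = k ^ 2 * q v) (hC : 0 ≤ C)
    (hgrowth : ∀ ξ, ‖ξ‖ ≤ C * (V ξ + 1))
    (hwell : ∀ r > (0 : ℝ), ∃ κ > (0 : ℝ), ∀ ξ, V ξ ≤ κ → ‖ξ - P‖ ≤ r ∨ ‖ξ + P‖ ≤ r)
    (hP : P ≠ 0) (hL : 0 ≤ L) (hδ : 0 < δ) :
    ∃ η > (0 : ℝ), ∀ ε, 0 < ε → ε ≤ η → ∀ (w : ℝ → V3) (z z' : ℝ → V3 × V3),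
      (∀ t ∈ II, HasDerivAt w (z t).1 t) → (∀ t ∈ II, HasDerivAt z (z' t) t) →
      ContinuousOn z' II →
      ∫⁻ t in II, ENNReal.ofReal (ε⁻¹ * V (z t) + ε * q (z' t)) ≤ ENNReal.ofReal L →
      ∫⁻ t in II, ENNReal.ofReal (‖w t - ub0 P.1 t‖ + ‖(z t).2 - bb0 P.2 t‖) ≤
        ENNReal.ofReal η →
      ∃ v v', Joins (fun x y => V x + q y) (-P) v P v' (δ + L + δ) := by
  have hφ : Continuous fun p : (V3 × V3) × (V3 × V3) => V p.1 + q p.2 := by fun_prop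
  obtain ⟨ρ₁, hρ₁, hcap₁⟩ := Joins.exists_cap (φ := fun x y => V x + q y) hφ
    (P := P) (by simp [hVP, hq0]) hδ
  obtain ⟨ρ₂, hρ₂, hcap₂⟩ := Joins.exists_cap (φ := fun x y => V x + q y) hφ
    (P := -P) (by simp [hVP', hq0]) hδ
  obtain ⟨η₁, hη₁, H₁⟩ := exists_near_well hC hgrowth hwell hP hL hρ₁
  obtain ⟨η₂, hη₂, H₂⟩ := exists_near_well (P := -P) hC hgrowth
    (fun r hr => by simpa [or_comm, sub_eq_add_neg] using hwell r hr) (neg_ne_zero.2 hP) hL hρ₂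
  refine ⟨min η₁ η₂, lt_min hη₁ hη₂, fun ε hε hεη w z z' hw hz hz' hE hD => ?_⟩
  set G : ℝ → ℝ := fun t => ε⁻¹ * V (z t) + ε * q (z' t) with hG
  have hq0' : ∀ v, 0 ≤ q v := fun v => (sq_nonneg _).trans (hq v)
  have hG0 : ∀ t, 0 ≤ G t := fun t =>
    add_nonneg (mul_nonneg (by positivity) (hV _)) (mul_nonneg hε.le (hq0' _))
  have hzc : ContinuousOn z II := fun t ht => (hz t ht).continuousAt.continuousWithinAt
  have hGc : ContinuousOn G II :=
    (continuousOn_const.mul (hVc.comp_continuousOn hzc)).add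
      (continuousOn_const.mul (hqc.comp_continuousOn hz'))
  have hGi : IntegrableOn G II := by
    rw [IntegrableOn, ← lintegral_ofReal_ne_top_iff_integrable
      (hGc.aestronglyMeasurable measurableSet_Ioo) (ae_of_all _ hG0)]
    exact ne_top_of_le_ne_top ENNReal.ofReal_ne_top hE
  have hGL : ∫ t in II, G t ≤ L := by
    rw [← ofReal_integral_eq_lintegral_ofReal hGi (ae_of_all _ hG0)] at hE
    exact (ENNReal.ofReal_le_ofReal_iff hL).1 hE
  have hGsub : ∀ s ⊆ II, ∫ t in s, G t ≤ L := fun s hs =>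
    (setIntegral_mono_set hGi (ae_of_all _ hG0) (ae_of_all _ hs)).trans hGL
  have hεG : ∀ t, ε * G t = V (z t) + q (ε • z' t) := by
    intro t; rw [hqs, hG]; field_simp
  have hVG : ∀ t, V ((z t).1, (z t).2) ≤ ε * G t := fun t => by
    rw [hεG]; exact le_add_of_nonneg_right (hq0' _)
  have hsub₁ : Ioo 0 (1 / 2 : ℝ) ⊆ II := Ioo_subset_Ioo (by norm_num) le_rfl
  have hsub₂ : Ioo (-(1 / 2) : ℝ) 0 ⊆ II := Ioo_subset_Ioo le_rfl (by norm_num)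
  obtain ⟨t, ht, htP, htG⟩ := H₁ ε hε (hεη.trans (min_le_left _ _)) 0 (1 / 2) w
    (fun t => (z t).1) (fun t => (z t).2) G (by norm_num) (fun t ht => hw t (hsub₁ ht))
    (hzc.mono hsub₁).fst (hGi.mono_set hsub₁) hG0 (hGsub _ hsub₁) hVG (by
      refine (le_trans ?_ (lintegral_mono_set hsub₁)).trans
        (hD.trans (ENNReal.ofReal_le_ofReal (min_le_left _ _)))
      refine setLIntegral_mono' measurableSet_Ioo fun t ht => le_of_eq ?_
      rw [ub0, bb0, if_pos ht.1.le, abs_of_pos ht.1])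
  obtain ⟨s, hs, hsP, hsG⟩ := H₂ ε hε (hεη.trans (min_le_right _ _)) (-(1 / 2)) 0 w
    (fun t => (z t).1) (fun t => (z t).2) G (by norm_num) (fun t ht => hw t (hsub₂ ht))
    (hzc.mono hsub₂).fst (hGi.mono_set hsub₂) hG0 (hGsub _ hsub₂) hVG (by
      refine (le_trans ?_ (lintegral_mono_set hsub₂)).trans
        (hD.trans (ENNReal.ofReal_le_ofReal (min_le_right _ _)))
      refine setLIntegral_mono' measurableSet_Ioo fun t ht => le_of_eq ?_
      rw [ub0, bb0, if_neg (not_le.2 ht.2), abs_of_neg ht.2]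
      simp)
  have hvel : ∀ {ρ : ℝ} x, 0 < ρ → ε * G x ≤ ρ ^ 2 → ‖ε • z' x‖ ≤ ρ := by
    intro ρ x hρ h
    rw [hεG] at h
    exact abs_le_of_sq_le_sq' (by linarith [hq (ε • z' x), hV (z x)]) hρ.le |>.2
  have hst : s < t := hs.2.trans ht.1
  have hIcc : Icc s t ⊆ II := fun x hx => ⟨hs.1.trans_le hx.1, hx.2.trans_lt ht.2⟩
  have hpath : IsC1PathOn z z' s t :=
    ⟨fun x hx => (hz x (hIcc hx)).hasDerivWithinAt, hz'.mono hIcc⟩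
  have hmid : Joins (fun x y => V x + q y) (z s) (ε • z' s) (z t) (ε • z' t) L := by
    refine Joins.of_path hst hε hpath ?_
    simp_rw [← hεG, inv_mul_cancel_left₀ hε.ne']
    rw [intervalIntegral.integral_of_le hst.le]
    exact hGsub _ (Ioc_subset_Icc_self.trans hIcc)
  obtain ⟨v', hv'⟩ := (hcap₁ (z t) (ε • z' t) htP (hvel t hρ₁ htG)).1
  obtain ⟨v, hv⟩ := (hcap₂ (z s) (ε • z' s) hsP (hvel s hρ₂ hsG)).2
  exact ⟨v, v', (hv.trans hφ hmid).trans hφ hv'⟩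

lemma continuous_vnorm : Continuous vnorm := by
  unfold vnorm; fun_prop

lemma vnorm_nonneg (v : V3) : 0 ≤ vnorm v := Real.sqrt_nonneg _

lemma norm_le_vnorm (v : V3) : ‖v‖ ≤ vnorm v := by
  refine (pi_norm_le_iff_of_nonneg (vnorm_nonneg v)).2 fun i => ?_
  rw [Real.norm_eq_abs, ← Real.sqrt_sq_eq_abs]
  exact Real.sqrt_le_sqrt (Finset.single_le_sum (f := fun i => v i ^ 2)
    (fun j _ => sq_nonneg _) (Finset.mem_univ i))

lemma vnorm_smul_sq (k : ℝ) (v : V3) : vnorm (k • v) ^ 2 = k ^ 2 * vnorm v ^ 2 := by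
  unfold vnorm
  rw [Real.sq_sqrt (by positivity), Real.sq_sqrt (by positivity), Finset.mul_sum]
  simp [mul_pow]

lemma norm_le_mnorm (ξ : M33) : ‖ξ‖ ≤ mnorm ξ := by
  have h0 : 0 ≤ mnorm ξ := Real.sqrt_nonneg _
  refine (pi_norm_le_iff_of_nonneg h0).2 fun j => (norm_le_vnorm _).trans ?_
  exact Real.sqrt_le_sqrt (Finset.single_le_sum (f := fun j => ∑ i, ξ j i ^ 2)
    (fun j _ => by positivity) (Finset.mem_univ j))

/-- The energy density restricted to matrices with vanishing middle column. -/
def reducedW (W : M33 → ℝ) (ξ : V3 × V3) : ℝ := W ![ξ.1, 0, ξ.2]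

/-- The kinetic part of the one-dimensional action. -/
noncomputable def kinetic (v : V3 × V3) : ℝ := vnorm v.1 ^ 2 + 2 * vnorm v.2 ^ 2

lemma continuous_reducedW {W : M33 → ℝ} (hW : Continuous W) : Continuous (reducedW W) := by
  refine hW.comp (continuous_pi fun j => ?_)
  fin_cases j
  · exact continuous_fst
  · exact continuous_const
  · exact continuous_snd

lemma continuous_kinetic : Continuous kinetic := by
  have := continuous_vnorm
  unfold kinetic; fun_prop

lemma kinetic_zero : kinetic 0 = 0 := by simp [kinetic, vnorm]

lemma norm_sq_le_kinetic (v : V3 × V3) : ‖v‖ ^ 2 ≤ kinetic v := by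
  have h1 := pow_le_pow_left₀ (norm_nonneg _) (norm_le_vnorm v.1) 2
  have h2 := pow_le_pow_left₀ (norm_nonneg _) (norm_le_vnorm v.2) 2
  rw [Prod.norm_def, kinetic]
  rcases max_cases ‖v.1‖ ‖v.2‖ with h | h <;> rw [h.1] <;>
    nlinarith [sq_nonneg (vnorm v.1), sq_nonneg (vnorm v.2)]

lemma kinetic_smul (k : ℝ) (v : V3 × V3) : kinetic (k • v) = k ^ 2 * kinetic v := by
  simp only [kinetic, Prod.smul_fst, Prod.smul_snd, vnorm_smul_sq]
  ring

lemma exists_growth {W : M33 → ℝ} {p : ℝ} (hp : 1 ≤ p) (hW : ∀ ξ, 0 ≤ W ξ) (h2 : H2 W p) :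
    ∃ C ≥ (0 : ℝ), ∀ ξ, ‖ξ‖ ≤ C * (reducedW W ξ + 1) := by
  obtain ⟨C, hC, h⟩ := h2
  refine ⟨max C (1 + C ^ 2), le_trans hC.le (le_max_left _ _), fun ξ => ?_⟩
  set M : M33 := ![ξ.1, 0, ξ.2] with hM
  have hlow : C⁻¹ * mnorm M ^ p - C ≤ reducedW W ξ := (h M).1
  have hm0 : 0 ≤ mnorm M := Real.sqrt_nonneg _
  have hm : mnorm M ≤ 1 + mnorm M ^ p := by
    rcases le_total (mnorm M) 1 with h1 | h1
    · linarith [Real.rpow_nonneg hm0 p]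
    · linarith [Real.self_le_rpow_of_one_le h1 hp]
  have hξ : ‖ξ‖ ≤ mnorm M := by
    refine le_trans ?_ (norm_le_mnorm M)
    rw [Prod.norm_def]
    exact max_le (norm_le_pi_norm M 0) (norm_le_pi_norm M 2)
  have hpow : mnorm M ^ p ≤ C * (reducedW W ξ + C) := by
    rwa [sub_le_iff_le_add, inv_mul_le_iff₀ hC] at hlow
  have hW0 : 0 ≤ reducedW W ξ := hW M
  nlinarith [mul_le_mul_of_nonneg_right (le_max_left C (1 + C ^ 2)) hW0,
    le_max_right C (1 + C ^ 2)]

lemma exists_near_of_small {V : V3 × V3 → ℝ} {P : V3 × V3} {C : ℝ} (hVc : Continuous V)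
    (hV : ∀ ξ, 0 ≤ V ξ) (hzero : ∀ ξ, V ξ = 0 → ξ = P ∨ ξ = -P) (hC : 0 ≤ C)
    (hgrowth : ∀ ξ, ‖ξ‖ ≤ C * (V ξ + 1)) {r : ℝ} (hr : 0 < r) :
    ∃ κ > (0 : ℝ), ∀ ξ, V ξ ≤ κ → ‖ξ - P‖ ≤ r ∨ ‖ξ + P‖ ≤ r := by
  set S : Set (V3 × V3) := Metric.closedBall 0 (C * 2) ∩ {ξ | r ≤ ‖ξ - P‖ ∧ r ≤ ‖ξ + P‖} with hS
  have hScomp : IsCompact S := by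
    refine (isCompact_closedBall _ _).inter_right (IsClosed.inter ?_ ?_)
    · exact isClosed_le continuous_const (continuous_id.sub continuous_const).norm
    · exact isClosed_le continuous_const (continuous_id.add continuous_const).norm
  have hmem : ∀ ξ, V ξ ≤ 1 → ¬(‖ξ - P‖ ≤ r ∨ ‖ξ + P‖ ≤ r) → ξ ∈ S := by
    intro ξ hξ hn
    push Not at hn
    refine ⟨?_, hn.1.le, hn.2.le⟩
    rw [mem_closedBall_zero_iff]
    exact (hgrowth ξ).trans (mul_le_mul_of_nonneg_left (by linarith) hC)
  rcases S.eq_empty_or_nonempty with hE | hne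
  · refine ⟨1, one_pos, fun ξ hξ => ?_⟩
    by_contra hn
    have := hmem ξ hξ hn
    rw [hE] at this
    exact this
  · obtain ⟨x, hx, hmin⟩ := hScomp.exists_isMinOn hne hVc.continuousOn
    have hpos : 0 < V x := by
      refine (hV x).lt_of_ne fun h0 => ?_
      rcases hzero x h0.symm with h | h
      · have := hx.2.1
        simp [h] at this; linarith
      · have := hx.2.2
        simp [h] at this; linarith
    refine ⟨min 1 (V x / 2), by positivity, fun ξ hξ => ?_⟩
    by_contra hn
    have h1 : V x ≤ V ξ := hmin (hmem ξ (hξ.trans (min_le_left _ _)) hn)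
    linarith [hξ.trans (min_le_right _ _)]

lemma K0_le_of_joins {W : M33 → ℝ} {a A3 : V3} {v v' : V3 × V3} {c : ℝ} (hWc : Continuous W)
    (hW : ∀ ξ, 0 ≤ W ξ)
    (h : Joins (fun x y => reducedW W x + kinetic y) (-(a, A3)) v (a, A3) v' c) :
    K0 W a A3 ≤ ENNReal.ofReal c := by
  obtain ⟨T, hT, z, z', hz, hz0, -, hzT, -, hc⟩ := h
  set l := T / 2 with hl
  have hl0 : 0 < l := by positivity
  have hy := hz.comp_affine (s' := -l) (t' := l) (k := 1) (d := l) zero_le_one (by ring)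
    (by rw [hl]; ring)
  simp only [one_mul, one_smul] at hy
  have hud : UniqueDiffOn ℝ (Icc (-l) l) := uniqueDiffOn_Icc (by linarith)
  have hd1 : ∀ x ∈ Icc (-l) l, HasDerivWithinAt (fun x => (z (x + l)).1) (z' (x + l)).1
      (Icc (-l) l) x := fun x hx =>
    (hasFDerivAt_fst (𝕜 := ℝ) (E := V3) (F := V3)).comp_hasDerivWithinAt x (hy.deriv x hx)
  have hd2 : ∀ x ∈ Icc (-l) l, HasDerivWithinAt (fun x => (z (x + l)).2) (z' (x + l)).2
      (Icc (-l) l) x := fun x hx =>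
    (hasFDerivAt_snd (𝕜 := ℝ) (E := V3) (F := V3)).comp_hasDerivWithinAt x (hy.deriv x hx)
  have hw1 := fun x hx => (hd1 x hx).derivWithin (hud x hx)
  have hw2 := fun x hx => (hd2 x hx).derivWithin (hud x hx)
  have hll : l + l = T := by rw [hl]; ring
  have hφ : Continuous fun p : (V3 × V3) × (V3 × V3) => reducedW W p.1 + kinetic p.2 := by
    have := continuous_reducedW hWc
    have := continuous_kinetic
    fun_prop
  have hφ0 : ∀ x, 0 ≤ reducedW W (z (x + l)) + kinetic (z' (x + l)) := fun x =>
    add_nonneg (hW _) ((sq_nonneg _).trans (norm_sq_le_kinetic _))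
  unfold K0
  refine sInf_le_of_le ⟨l, hl0, fun x => (z (x + l)).1, fun x => (z (x + l)).2, ?_, ?_,
    by simp [hll, hzT], by simp [hll, hzT], by simp [hz0], by simp [hz0], rfl⟩ ?_
  · exact (contDiffOn_one_iff_derivWithin hud).2 ⟨fun x hx => (hd1 x hx).differentiableWithinAt,
      hy.cont.fst.congr hw1⟩
  · exact (contDiffOn_one_iff_derivWithin hud).2 ⟨fun x hx => (hd2 x hx).differentiableWithinAt,
      hy.cont.snd.congr hw2⟩
  · have hint : IntegrableOn (fun x => reducedW W (z (x + l)) + kinetic (z' (x + l)))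
        (Ioo (-l) l) :=
      (hy.continuousOn_lagrangian (φ := fun x y => reducedW W x + kinetic y) hφ).integrableOn_Icc.mono_set Ioo_subset_Icc_self
    calc _ = ∫⁻ x in Ioo (-l) l,
          ENNReal.ofReal (reducedW W (z (x + l)) + kinetic (z' (x + l))) := by
          refine setLIntegral_congr_fun measurableSet_Ioo fun x hx => ?_
          simp only
          rw [hw1 x (Ioo_subset_Icc_self hx), hw2 x (Ioo_subset_Icc_self hx), add_assoc]
          rfl
      _ = ENNReal.ofReal (∫ x in Ioo (-l) l, (reducedW W (z (x + l)) + kinetic (z' (x + l)))) :=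
          (ofReal_integral_eq_lintegral_ofReal hint (ae_of_all _ hφ0)).symm
      _ ≤ ENNReal.ofReal c := by
          apply ENNReal.ofReal_le_ofReal
          rw [← integral_Ioc_eq_integral_Ioo, ← intervalIntegral.integral_of_le (by linarith),
            intervalIntegral.integral_comp_add_right
              (fun x => reducedW W (z x) + kinetic (z' x)) l]
          simpa [hll] using hc

lemma exists_slice {g d : ℝ × ℝ → ℝ≥0∞} {c η : ℝ} (hc : 0 < c) (hη : 0 < η)
    (hg : AEMeasurable g (volume.restrict (II ×ˢ II)))
    (hd : AEMeasurable d (volume.restrict (II ×ˢ II)))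
    (h : ∫⁻ y in II ×ˢ II, g y + ENNReal.ofReal (c / η) * d y < ENNReal.ofReal c) :
    ∃ s ∈ II, ∫⁻ t in II, g (t, s) ≤ ENNReal.ofReal c ∧
      ∫⁻ t in II, d (t, s) ≤ ENNReal.ofReal η := by
  have hvol : (volume.restrict (II ×ˢ II) : Measure (ℝ × ℝ)) =
      (volume.restrict II).prod (volume.restrict II) := by
    rw [Measure.prod_restrict]; rfl
  have hM : ENNReal.ofReal (c / η) ≠ ⊤ := ENNReal.ofReal_ne_top
  rw [hvol] at h hg hd
  rw [lintegral_prod_symm (fun y => g y + ENNReal.ofReal (c / η) * d y)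
    (hg.add (hd.const_mul _))] at h
  obtain ⟨s, hs, hlt⟩ : ∃ s ∈ II,
      ∫⁻ t in II, (g (t, s) + ENNReal.ofReal (c / η) * d (t, s)) < ENNReal.ofReal c := by
    by_contra! hcon
    refine absurd h (not_lt.2 ?_)
    calc ENNReal.ofReal c = ∫⁻ _ in II, ENNReal.ofReal c := by
          rw [setLIntegral_const, II, Real.volume_Ioo]; norm_num
      _ ≤ _ := setLIntegral_mono' measurableSet_Ioo hcon
  refine ⟨s, hs, (lintegral_mono fun t => le_self_add).trans hlt.le, ?_⟩
  have h2 : ENNReal.ofReal (c / η) * ∫⁻ t in II, d (t, s) ≤ ENNReal.ofReal c := by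
    rw [← lintegral_const_mul' _ _ hM]
    exact (lintegral_mono fun t => le_add_self).trans hlt.le
  have h3 : ENNReal.ofReal c = ENNReal.ofReal (c / η) * ENNReal.ofReal η := by
    rw [← ENNReal.ofReal_mul (by positivity), div_mul_cancel₀ _ hη.ne']
  rw [h3] at h2
  exact (ENNReal.mul_le_mul_iff_right (ENNReal.ofReal_pos.2 (by positivity)).ne' hM).1 h2

lemma contDiffOn_qd {n m : WithTop ℕ∞} {U : Set Pt2} (hU : IsOpen U) {u : Pt2 → V3} (e : Pt2)
    (hu : ContDiffOn ℝ n u U) (hmn : m + 1 ≤ n) : ContDiffOn ℝ m (qd e u) U :=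
  (hu.fderiv_of_isOpen hU hmn).clm_apply contDiffOn_const

lemma hasDerivAt_slice {U : Set Pt2} (hU : IsOpen U) {u : Pt2 → V3} (hu : ContDiffOn ℝ 1 u U)
    {t s : ℝ} (h : (t, s) ∈ U) : HasDerivAt (fun t => u (t, s)) (qd f1 u (t, s)) t := by
  have h1 : HasFDerivAt u (fderiv ℝ u (t, s)) (t, s) :=
    ((hu.differentiableOn (by norm_num)).differentiableAt (hU.mem_nhds h)).hasFDerivAt
  exact h1.comp_hasDerivAt t ((hasDerivAt_id' t).prodMk (hasDerivAt_const t s))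

lemma isOpen_square : IsOpen (II ×ˢ II) := isOpen_Ioo.prod isOpen_Ioo

/-- Dropping the derivatives in the second variable decreases the energy. -/
lemma lintegral_reduced_le_F0 {W : M33 → ℝ} (h4 : H4 W) {ε : ℝ} (hε : 0 < ε)
    (u b : Pt2 → V3) (D : Set Pt2) :
    ∫⁻ y in D, ENNReal.ofReal (ε⁻¹ * reducedW W (qd f1 u y, b y) +
      ε * kinetic (qd f1 (qd f1 u) y, qd f1 b y)) ≤ F0 W ε u b D := by
  refine lintegral_mono fun y => ENNReal.ofReal_le_ofReal (add_le_add ?_ ?_)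
  · refine mul_le_mul_of_nonneg_left ?_ (by positivity)
    exact h4 ![qd f1 u y, qd f2 u y, b y]
  · refine mul_le_mul_of_nonneg_left ?_ hε.le
    simp only [kinetic]
    nlinarith [sq_nonneg (vnorm (qd f2 (qd f1 u) y)), sq_nonneg (vnorm (qd f2 (qd f2 u) y)),
      sq_nonneg (vnorm (qd f2 b y))]

/-- Corollary 5.5: K*₀ ≥ K₀. -/
theorem statement13 (p : ℝ) (hp : 2 ≤ p) (A B : M33) (W : M33 → ℝ) (a : V3)
    (hWc : Continuous W) (h1 : H1 W A B) (h2 : H2 W p) (h3 : H3 W A B p) (h4 : H4 W)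
    (hwells : Wells A B a) :
    K0 W a (A 2) ≤ Kstar0 W a (A 2) := by
  obtain ⟨hW, hzero, hAB, -⟩ := h1
  obtain ⟨hBA, hA0, hA1⟩ := hwells
  have hB : B = -A := by rw [hBA, neg_neg]
  have hA : ![a, 0, A 2] = A := by
    ext j; fin_cases j <;> simp [hA0, hA1]
  have hnegA : ![-a, 0, -A 2] = B := by
    rw [hB]; ext j; fin_cases j <;> simp [hA0, hA1]
  set P : V3 × V3 := (a, A 2) with hPdef
  have hVP : reducedW W P = 0 := by
    rw [reducedW, hzero]; exact Or.inl hA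
  have hVP' : reducedW W (-P) = 0 := by
    rw [reducedW, hzero]; exact Or.inr hnegA
  have hP : P ≠ 0 := by
    intro h
    have ha : a = 0 := congrArg Prod.fst h
    have hA2 : A 2 = 0 := congrArg Prod.snd h
    apply hAB
    rw [← hA, ← hnegA, ha, hA2, neg_zero]
  have hVzero : ∀ ξ, reducedW W ξ = 0 → ξ = P ∨ ξ = -P := by
    intro ξ hξ
    rw [reducedW, hzero, ← hnegA] at hξ
    rcases hξ with h | h
    · left
      exact Prod.ext ((congrFun h 0).trans hA0) (congrFun h 2)
    · right
      exact Prod.ext (congrFun h 0) (congrFun h 2)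
  obtain ⟨C, hC, hgrowth⟩ := exists_growth (by linarith : 1 ≤ p) hW h2
  have hVc := continuous_reducedW hWc
  have hV : ∀ ξ, 0 ≤ reducedW W ξ := fun ξ => hW _
  refine le_sInf ?_
  rintro L ⟨ε, u, b, hε, hε0, hu, hb, hconv, rfl⟩
  refine ENNReal.le_of_forall_pos_le_add fun δ hδ hLtop => ?_
  set L := liminf (fun n => F0 W (ε n) (u n) (b n) (II ×ˢ II)) atTop with hL
  have hδ' : (0 : ℝ) < δ := hδ
  set δ₀ : ℝ := δ / 4 with hδ₀
  have hδ₀' : 0 < δ₀ := by positivity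
  set c : ℝ := L.toReal + 2 * δ₀ with hc
  have hc0 : 0 < c := by positivity
  have hLc : L + ENNReal.ofReal (2 * δ₀) = ENNReal.ofReal c := by
    rw [hc, ENNReal.ofReal_add ENNReal.toReal_nonneg (by positivity),
      ENNReal.ofReal_toReal hLtop.ne]
  obtain ⟨η, hη, H⟩ := exists_joins_wells hVc continuous_kinetic hV hVP hVP' kinetic_zero
    norm_sq_le_kinetic kinetic_smul hC hgrowth
    (fun r hr => exists_near_of_small hVc hV hVzero hC hgrowth hr) hP hc0.le hδ₀'
  have hfreq : ∃ᶠ n in atTop, F0 W (ε n) (u n) (b n) (II ×ˢ II) < L + ENNReal.ofReal δ₀ :=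
    frequently_lt_of_liminf_lt (by isBoundedDefault)
      (ENNReal.lt_add_right hLtop.ne (ENNReal.ofReal_pos.2 hδ₀').ne')
  have hevε : ∀ᶠ n in atTop, ε n ≤ η := (hε0.eventually_lt_const hη).mono fun _ h => h.le
  have hevd := (ENNReal.Tendsto.const_mul (a := ENNReal.ofReal (c / η)) hconv
    (Or.inr ENNReal.ofReal_ne_top)).eventually_lt_const
      (by rw [mul_zero]; exact ENNReal.ofReal_pos.2 hδ₀')
  obtain ⟨n, hFn, hεn, hdn⟩ := (hfreq.and_eventually (hevε.and hevd)).exists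
  have hu1 : ContDiffOn ℝ 1 (qd f1 (u n)) (II ×ˢ II) :=
    contDiffOn_qd isOpen_square f1 (hu n) (by norm_num)
  have hu11 : ContinuousOn (qd f1 (qd f1 (u n))) (II ×ˢ II) :=
    (contDiffOn_qd (m := 0) isOpen_square f1 hu1 (by norm_num)).continuousOn
  have hb1 : ContinuousOn (qd f1 (b n)) (II ×ˢ II) :=
    (contDiffOn_qd (m := 0) isOpen_square f1 (hb n) (by norm_num)).continuousOn
  have hmeas : MeasurableSet (II ×ˢ II) := measurableSet_Ioo.prod measurableSet_Ioo
  have hgm : AEMeasurable (fun y => ENNReal.ofReal ((ε n)⁻¹ * reducedW W (qd f1 (u n) y, b n y) +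
      ε n * kinetic (qd f1 (qd f1 (u n)) y, qd f1 (b n) y))) (volume.restrict (II ×ˢ II)) := by
    refine (ContinuousOn.aemeasurable ?_ hmeas).ennreal_ofReal
    exact (continuousOn_const.mul (hVc.comp_continuousOn
        (hu1.continuousOn.prodMk (hb n).continuousOn))).add
      (continuousOn_const.mul (continuous_kinetic.comp_continuousOn (hu11.prodMk hb1)))
  have hdm : AEMeasurable (fun y : Pt2 => ENNReal.ofReal (vnorm (u n y - ub0 a y.1) +
      vnorm (b n y - bb0 (A 2) y.1))) (volume.restrict (II ×ˢ II)) := by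
    have hbb : Measurable fun y : Pt2 => bb0 (A 2) y.1 :=
      Measurable.ite (measurableSet_le measurable_const measurable_fst) measurable_const
        measurable_const
    have hub : Measurable fun y : Pt2 => ub0 a y.1 := by
      have : Continuous fun y : Pt2 => ub0 a y.1 := by unfold ub0; fun_prop
      exact this.measurable
    have hum := (hu n).continuousOn.aemeasurable (μ := volume) hmeas
    have hbm := (hb n).continuousOn.aemeasurable (μ := volume) hmeas
    exact ((continuous_vnorm.measurable.comp_aemeasurable (hum.sub hub.aemeasurable)).add
      (continuous_vnorm.measurable.comp_aemeasurable (hbm.sub hbb.aemeasurable))).ennreal_ofReal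
  obtain ⟨s, hs, hsE, hsD⟩ := exists_slice hc0 hη hgm hdm (by
    rw [lintegral_add_left' hgm, lintegral_const_mul' _ _ ENNReal.ofReal_ne_top, ← hLc, two_mul,
      ENNReal.ofReal_add hδ₀'.le hδ₀'.le, ← add_assoc]
    exact ENNReal.add_lt_add ((lintegral_reduced_le_F0 h4 (hε n) _ _ _).trans_lt hFn) hdn)
  have hslice : ∀ t ∈ II, (t, s) ∈ II ×ˢ II := fun t ht => ⟨ht, hs⟩
  have hslc : ContinuousOn (fun t : ℝ => (t, s)) II := by fun_prop
  obtain ⟨v, v', hj⟩ := H (ε n) (hε n) hεn (fun t => u n (t, s))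
    (fun t => (qd f1 (u n) (t, s), b n (t, s)))
    (fun t => (qd f1 (qd f1 (u n)) (t, s), qd f1 (b n) (t, s)))
    (fun t ht => hasDerivAt_slice isOpen_square ((hu n).of_le (by norm_num)) (hslice t ht))
    (fun t ht => (hasDerivAt_slice isOpen_square hu1 (hslice t ht)).prodMk
      (hasDerivAt_slice isOpen_square (hb n) (hslice t ht)))
    ((hu11.comp hslc hslice).prodMk (hb1.comp hslc hslice)) hsE
    ((lintegral_mono fun t => ENNReal.ofReal_le_ofReal
      (add_le_add (norm_le_vnorm _) (norm_le_vnorm _))).trans hsD)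
  refine (K0_le_of_joins hWc hW hj).trans (le_of_eq ?_)
  have hsum : δ₀ + c + δ₀ = L.toReal + δ := by rw [hc, hδ₀]; ring
  rw [hsum, ENNReal.ofReal_add ENNReal.toReal_nonneg hδ'.le, ENNReal.ofReal_toReal hLtop.ne,
    ENNReal.ofReal_coe_nnreal]
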